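/- The zero-information profiles {(s_1^r,…,s_N^r) : s_1^r,…,s_N^r ∈ S^r} are all equilibria of the competitive protocol F^c if and only if they are all equilibria of every protocol F = (F_1,…,F_N). -/

import Mathlib

open scoped Classical
noncomputable section

/-- A strategy of an agent: `(p, q)` with `p = P(mᵢ = 0 ∣ bᵢ = 0)`, `q = P(mᵢ = 0 ∣ bᵢ = 1)`. -/
abbrev Strategy : Type := (Set.Icc (0:ℝ) 1) × (Set.Icc (0:ℝ) 1)

/-- The truthful strategy `sᵗ = (1,0)`. -/
def sT : Strategy := (⟨1, by norm_num⟩, ⟨0, by norm_num⟩)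

/-- A zero-information strategy: `p = q`. -/
def ZeroInfo (s : Strategy) : Prop := (s.1 : ℝ) = (s.2 : ℝ)

/-- Vectors of `N+1` bits (bits of the center and the `N` agents; also used for
message vectors and for the center's replies).  Coordinate `0` is the center. -/
abbrev Bits (N : ℕ) : Type := Fin (N+1) → Bool

/-- A strategy profile of the `N` agents. -/
abbrev Profile (N : ℕ) : Type := Fin N → Strategy

/-- A protocol for a single agent: a map from strategy profiles and message vectors to
distributions over replies `f ∈ {0,1}^{N+1}`. -/
abbrev Protocol (N : ℕ) : Type := Profile N → Bits N → PMF (Bits N)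

/-- `P(message = msg ∣ bit = bit)` under strategy `s` (where `false` plays the role of `0`). -/
def strandP (s : Strategy) (bit msg : Bool) : ℝ :=
  if msg then 1 - (if bit then (s.2 : ℝ) else (s.1 : ℝ))
  else (if bit then (s.2 : ℝ) else (s.1 : ℝ))

/-- `P(messages = m ∣ bits = b)` under profile `s`; the center's message is her own bit. -/
def msgP {N : ℕ} (s : Profile N) (b m : Bits N) : ℝ :=
  (if m 0 = b 0 then (1:ℝ) else 0) * ∏ i : Fin N, strandP (s i) (b i.succ) (m i.succ)

/-- Joint probability of bits `b`, messages `m` and reply `f` (to the relevant agent),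
under profile `s` and protocol `F`; bits are i.i.d. uniform. -/
def jointP {N : ℕ} (s : Profile N) (F : Protocol N) (b m f : Bits N) : ℝ :=
  ((1:ℝ)/2)^(N+1) * msgP s b m * ((F s m) f).toReal

/-- `P(bᵢ = bi, mᵢ = mi, fᵢ = f, g(b) = val)` for agent `i` (coordinate `i.succ`). -/
def pObs {N : ℕ} (g : Bits N → Bool) (s : Profile N) (F : Protocol N) (i : Fin N)
    (bi mi : Bool) (f : Bits N) (val : Bool) : ℝ :=
  ∑ b : Bits N, ∑ m : Bits N,
    if b i.succ = bi ∧ m i.succ = mi ∧ g b = val then jointP s F b m f else 0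

/-- `P(bᵢ = bi, mᵢ = mi, fᵢ = f)` for agent `i`. -/
def pObsAll {N : ℕ} (s : Profile N) (F : Protocol N) (i : Fin N)
    (bi mi : Bool) (f : Bits N) : ℝ :=
  ∑ b : Bits N, ∑ m : Bits N,
    if b i.succ = bi ∧ m i.succ = mi then jointP s F b m f else 0

/-- `P(b_k = 1, bᵢ = bi, mᵢ = mi, fᵢ = f)` for agent `i`. -/
def pBit {N : ℕ} (s : Profile N) (F : Protocol N) (i : Fin N)
    (bi mi : Bool) (f : Bits N) (k : Fin (N+1)) : ℝ :=
  ∑ b : Bits N, ∑ m : Bits N,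
    if b i.succ = bi ∧ m i.succ = mi ∧ b k = true then jointP s F b m f else 0

/-- The posterior `v_k = P(b_k = 1 ∣ fᵢ, mᵢ, bᵢ)` of agent `i` at the realization
`(bi, mi, f)`. -/
def post {N : ℕ} (s : Profile N) (F : Protocol N) (i : Fin N)
    (bi mi : Bool) (f : Bits N) (k : Fin (N+1)) : ℝ :=
  pBit s F i bi mi f k / pObsAll s F i bi mi f

/-- Expected profit `V_i(s⃗; F_i)`: after observing `(bᵢ, mᵢ, fᵢ)` the agent guesses the
more likely value of `g(b)` (uniformly at random in case of a tie) and earns `c i` iff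
the guess is correct. -/
def V {N : ℕ} (g : Bits N → Bool) (c : Fin N → ℝ) (s : Profile N) (F : Protocol N)
    (i : Fin N) : ℝ :=
  c i * ∑ bi : Bool, ∑ mi : Bool, ∑ f : Bits N,
    (if pObs g s F i bi mi f true > pObs g s F i bi mi f false then pObs g s F i bi mi f true
     else if pObs g s F i bi mi f false > pObs g s F i bi mi f true then
       pObs g s F i bi mi f false
     else (pObs g s F i bi mi f false + pObs g s F i bi mi f true) / 2)

/-- Utility `U_i(s⃗; F_i) = V_i(s⃗; F_i) − priceᵢ(sᵢ)`. -/
def U {N : ℕ} (g : Bits N → Bool) (c : Fin N → ℝ) (price : Fin N → Strategy → ℝ)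
    (s : Profile N) (F : Protocol N) (i : Fin N) : ℝ :=
  V g c s F i - price i (s i)

/-- The all-truthful profile `(sᵗ, …, sᵗ)`. -/
def truthProfile (N : ℕ) : Profile N := fun _ => sT

/-- `s⃗` is an equilibrium of the protocol `F = (F_1,…,F_N)`. -/
def Equilibrium {N : ℕ} (g : Bits N → Bool) (c : Fin N → ℝ) (price : Fin N → Strategy → ℝ)
    (s : Profile N) (FF : Fin N → Protocol N) : Prop :=
  ∀ i : Fin N, ∀ s' : Strategy,
    U g c price s (FF i) i ≥ U g c price (Function.update s i s') (FF i) i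

/-- The improvement `F_i⁺` of a protocol `F_i`: it agrees with `F_i` when `s_i` is a
zero-information strategy, and otherwise returns the reply whose first coordinate is
`m₀ = b₀` and whose remaining coordinates are those of `F_i`'s reply. -/
def improve {N : ℕ} (i : Fin N) (F : Protocol N) : Protocol N := fun s m =>
  if ZeroInfo (s i) then F s m
  else PMF.map (fun f => Function.update f 0 (m 0)) (F s m)

/-- The center is helpless. -/
def Helpless (N : ℕ) (g : Bits N → Bool) (c : Fin N → ℝ)
    (price : Fin N → Strategy → ℝ) : Prop :=
  ∀ i : Fin N, ∀ F : Protocol N, ∀ si : Strategy, ¬ ZeroInfo si →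
    ∀ sr : Profile N, (∀ j, ZeroInfo (sr j)) →
      U g c price sr F i ≥ U g c price (Function.update sr i si) (improve i F) i

/-- Relative price `price_i^r(s_i) = price_i(s_i) / price_i(sᵗ)`. -/
def priceR {N : ℕ} (price : Fin N → Strategy → ℝ) (i : Fin N) (s : Strategy) : ℝ :=
  price i s / price i sT

/-- The competitive protocol (the component `F_i^c` for agent `i`). -/
def Fc {N : ℕ} (price : Fin N → Strategy → ℝ) (i : Fin N) : Protocol N := fun s m =>
  if ∀ j, s j = sT then PMF.pure m
  else if ∀ j, j ≠ i → priceR price j (s j) < priceR price i (s i) then PMF.pure m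
  else PMF.uniformOfFintype (Bits N)

/-- The protocol that always replies the full message vector `m = (b₀, m₁, …, m_N)`. -/
def Fmax (N : ℕ) : Protocol N := fun _ m => PMF.pure m

/-- The protocol that always replies `N+1` independent uniform random bits. -/
def Fmin (N : ℕ) : Protocol N := fun _ _ => PMF.uniformOfFintype (Bits N)

/-- Agent `i` is fanatic. -/
def Fanatic {N : ℕ} (g : Bits N → Bool) (c : Fin N → ℝ) (price : Fin N → Strategy → ℝ)
    (i : Fin N) : Prop :=
  ∀ s : Profile N,
    price i sT > V g c (truthProfile N) (Fmax N) i - V g c s (Fmin N) i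

/-- The fair competitive protocol (the component `F_i^{fc}` for agent `i`). -/
def Ffc {N : ℕ} (price : Fin N → Strategy → ℝ) (i : Fin N) : Protocol N := fun s m =>
  if s i = sT then PMF.pure m
  else if (∃ j, j ≠ i ∧ s j ≠ sT) ∧
      (∀ j, j ≠ i → s j ≠ sT → priceR price j (s j) < priceR price i (s i)) then PMF.pure m
  else PMF.uniformOfFintype (Bits N)

/-- `P(bᵢ = bi, g(b) = v)`. -/
def bitProb {N : ℕ} (g : Bits N → Bool) (i : Fin N) (bi v : Bool) : ℝ :=
  ∑ b : Bits N, if b i.succ = bi ∧ g b = v then ((1:ℝ)/2)^(N+1) else 0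

/-- `P(bᵢ = bi, b₀ = x, g(b) = v)`. -/
def centerProb {N : ℕ} (g : Bits N → Bool) (i : Fin N) (bi x v : Bool) : ℝ :=
  ∑ b : Bits N, if b i.succ = bi ∧ g b = v then
    ((1:ℝ)/2)^(N+1) * (if x = b 0 then 1 else 0) else 0

lemma strandP_nonneg (s : Strategy) (b m : Bool) : 0 ≤ strandP s b m := by
  have h1 := s.1.2.1
  have h2 := s.1.2.2
  have h3 := s.2.2.1
  have h4 := s.2.2.2
  cases b <;> cases m <;> simp [strandP] <;> assumption

lemma sum_strandP (s : Strategy) (b : Bool) : ∑ m, strandP s b m = 1 := by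
  simp [strandP]

lemma strandP_eq_of_zeroInfo {s : Strategy} (h : ZeroInfo s) (b b' m : Bool) :
    strandP s b m = strandP s b' m := by
  unfold ZeroInfo at h
  cases b <;> cases b' <;> simp [strandP, h]

lemma not_zeroInfo_sT : ¬ ZeroInfo sT := by
  simp [ZeroInfo, sT]

lemma sum_bits_mul_prod {N : ℕ} (φ : Bool → ℝ) (h : Fin N → Bool → ℝ) :
    ∑ m : Bits N, φ (m 0) * ∏ j, h j (m j.succ) = (∑ x, φ x) * ∏ j, ∑ x, h j x := by
  rw [← (Fin.consEquiv fun _ : Fin (N+1) => Bool).sum_comp, Fintype.sum_prod_type,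
    Finset.prod_univ_sum, Finset.sum_mul_sum]
  simp only [Fin.consEquiv, Equiv.coe_fn_mk, Fin.cons_zero, Fin.cons_succ, Fintype.piFinset_univ]

lemma sum_bits_mul_prod_strandP {N : ℕ} (φ : Bool → ℝ) (s : Profile N) (d : Fin N → Bool) :
    ∑ m : Bits N, φ (m 0) * ∏ j, strandP (s j) (d j) (m j.succ) = ∑ x, φ x := by
  rw [sum_bits_mul_prod φ fun j x => strandP (s j) (d j) x]
  simp only [sum_strandP, Finset.prod_const_one, mul_one]

lemma sum_msgP {N : ℕ} (s : Profile N) (b : Bits N) : ∑ m, msgP s b m = 1 := by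
  unfold msgP
  rw [sum_bits_mul_prod_strandP (fun x => if x = b 0 then 1 else 0) s fun j => b j.succ]
  simp

lemma sum_center_mul_msgP {N : ℕ} (s : Profile N) (b : Bits N) (x : Bool) :
    ∑ m, msgP s b m * (if x = m 0 then 1 else 0) = if x = b 0 then 1 else 0 := by
  unfold msgP
  have h := sum_bits_mul_prod_strandP
    (fun y => (if y = b 0 then (1:ℝ) else 0) * (if x = y then 1 else 0)) s fun j => b j.succ
  rw [← (show _ = (if x = b 0 then (1:ℝ) else 0) from h.trans (by simp))]
  exact Finset.sum_congr rfl fun m _ => by ring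

lemma sum_msgP_own {N : ℕ} (s : Profile N) (b : Bits N) (i : Fin N) (mi : Bool) :
    ∑ m, (if m i.succ = mi then msgP s b m else 0) = strandP (s i) (b i.succ) mi := by
  have h := sum_bits_mul_prod (fun x => if x = b 0 then (1:ℝ) else 0)
    fun j x => (if j = i then if x = mi then 1 else 0 else 1) * strandP (s j) (b j.succ) x
  have hprod : ∏ j, ∑ x, (if j = i then if x = mi then (1:ℝ) else 0 else 1) *
      strandP (s j) (b j.succ) x = strandP (s i) (b i.succ) mi := by
    rw [Finset.prod_eq_single i]
    · simp
    · intro j _ hj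
      simp [hj, sum_strandP, -Fintype.univ_bool]
    · simp
  rw [hprod] at h
  rw [← (show _ = strandP (s i) (b i.succ) mi from h.trans (by simp))]
  refine Finset.sum_congr rfl fun m _ => ?_
  rw [Finset.prod_mul_distrib, Finset.prod_ite_eq' Finset.univ i]
  simp only [msgP, Finset.mem_univ, if_true]
  split_ifs <;> simp

lemma sum_toReal_pmf {α : Type*} [Fintype α] (p : PMF α) : ∑ a, (p a).toReal = 1 := by
  rw [← ENNReal.toReal_sum fun a _ => p.apply_ne_top a, ← tsum_fintype (L := .unconditional _),
    p.tsum_coe, ENNReal.toReal_one]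

lemma V_eq_sum_max {N : ℕ} (g : Bits N → Bool) (c : Fin N → ℝ) (s : Profile N) (F : Protocol N)
    (i : Fin N) :
    V g c s F i = c i * ∑ bi, ∑ mi, ∑ f,
      max (pObs g s F i bi mi f true) (pObs g s F i bi mi f false) := by
  unfold V
  congr 1
  refine Finset.sum_congr rfl fun bi _ => Finset.sum_congr rfl fun mi _ =>
    Finset.sum_congr rfl fun f _ => ?_
  split_ifs with h1 h2
  · exact (max_eq_left h1.le).symm
  · exact (max_eq_right h2.le).symm
  · rw [le_antisymm (not_lt.1 h1) (not_lt.1 h2), max_self, add_self_div_two]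

lemma V_congr {N : ℕ} (g : Bits N → Bool) (c : Fin N → ℝ) {s : Profile N} {F F' : Protocol N}
    (h : F s = F' s) (i : Fin N) : V g c s F i = V g c s F' i := by
  simp only [V_eq_sum_max, pObs, jointP, h]

lemma sum_weight_mul_pObs {N : ℕ} (g : Bits N → Bool) (s : Profile N) (F : Protocol N)
    (i : Fin N) (bi v : Bool) (w : Bits N → ℝ) :
    ∑ mi, ∑ f, w f * pObs g s F i bi mi f v =
      ∑ b, if b i.succ = bi ∧ g b = v then
        ((1:ℝ)/2)^(N+1) * ∑ m, msgP s b m * ∑ f, w f * (F s m f).toReal else 0 := by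
  calc _ = ∑ mi, ∑ f, ∑ b, w f * ∑ m,
        (if b i.succ = bi ∧ m i.succ = mi ∧ g b = v then jointP s F b m f else 0) := by
        simp only [pObs, Finset.mul_sum]
    _ = ∑ b, ∑ mi, ∑ f, w f * ∑ m,
        (if b i.succ = bi ∧ m i.succ = mi ∧ g b = v then jointP s F b m f else 0) := by
        rw [Finset.sum_comm (s := (Finset.univ : Finset (Bits N)))]
        exact Finset.sum_congr rfl fun mi _ => Finset.sum_comm
    _ = _ := ?_
  refine Finset.sum_congr rfl fun b _ => ?_
  by_cases h : b i.succ = bi ∧ g b = v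
  · obtain ⟨rfl, rfl⟩ := h
    simp only [true_and, and_true, and_self, if_true]
    rw [Finset.sum_comm]
    simp only [← Finset.mul_sum]
    simp only [Finset.sum_comm (s := (Finset.univ : Finset Bool)), Finset.sum_ite_eq,
      Finset.mem_univ, if_true, jointP, Finset.mul_sum]
    rw [Finset.sum_comm]
    exact Finset.sum_congr rfl fun m _ => Finset.sum_congr rfl fun f _ => by ring
  · rw [if_neg h]
    refine Finset.sum_eq_zero fun mi _ => Finset.sum_eq_zero fun f _ => ?_
    rw [Finset.sum_eq_zero, mul_zero]
    exact fun m _ => if_neg fun hm => h ⟨hm.1, hm.2.2⟩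

lemma sum_pObs {N : ℕ} (g : Bits N → Bool) (s : Profile N) (F : Protocol N)
    (i : Fin N) (bi v : Bool) :
    ∑ mi, ∑ f, pObs g s F i bi mi f v = bitProb g i bi v := by
  have h := sum_weight_mul_pObs g s F i bi v fun _ => 1
  simp only [one_mul, sum_toReal_pmf, mul_one, sum_msgP] at h
  exact h

lemma sum_center_mul_pObs_Fmax {N : ℕ} (g : Bits N → Bool) (s : Profile N)
    (i : Fin N) (bi x v : Bool) :
    ∑ mi, ∑ f, (if x = f 0 then 1 else 0) * pObs g s (Fmax N) i bi mi f v =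
      centerProb g i bi x v := by
  have hpure (m : Bits N) : ∑ f, (if x = f 0 then (1:ℝ) else 0) * (Fmax N s m f).toReal =
      if x = m 0 then 1 else 0 := by
    rw [Finset.sum_eq_single m]
    · simp [Fmax]
    · intro f _ hf
      simp [Fmax, hf]
    · simp
  rw [sum_weight_mul_pObs]
  simp only [hpure, sum_center_mul_msgP]
  rfl

/-- Every protocol gives at least the profit of guessing from one's own bit alone. -/
lemma V_ge_bitProb {N : ℕ} (g : Bits N → Bool) {c : Fin N → ℝ} (s : Profile N) (F : Protocol N)
    {i : Fin N} (hc : 0 < c i) :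
    c i * ∑ bi, max (bitProb g i bi true) (bitProb g i bi false) ≤ V g c s F i := by
  rw [V_eq_sum_max]
  refine mul_le_mul_of_nonneg_left (Finset.sum_le_sum fun bi _ => max_le ?_ ?_) hc.le
  · rw [← sum_pObs g s F]
    exact Finset.sum_le_sum fun _ _ => Finset.sum_le_sum fun _ _ => le_max_left _ _
  · rw [← sum_pObs g s F]
    exact Finset.sum_le_sum fun _ _ => Finset.sum_le_sum fun _ _ => le_max_right _ _

/-- The full message vector gives at least the profit of guessing from one's own bit and the
center's bit. -/
lemma V_Fmax_ge_centerProb {N : ℕ} (g : Bits N → Bool) {c : Fin N → ℝ} (s : Profile N)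
    {i : Fin N} (hc : 0 < c i) :
    c i * ∑ bi, ∑ x, max (centerProb g i bi x true) (centerProb g i bi x false) ≤
      V g c s (Fmax N) i := by
  rw [V_eq_sum_max]
  refine mul_le_mul_of_nonneg_left (Finset.sum_le_sum fun bi _ => ?_) hc.le
  have hsplit : ∑ mi, ∑ f, max (pObs g s (Fmax N) i bi mi f true)
        (pObs g s (Fmax N) i bi mi f false) =
      ∑ x, ∑ mi, ∑ f, (if x = f 0 then 1 else 0) * max (pObs g s (Fmax N) i bi mi f true)
        (pObs g s (Fmax N) i bi mi f false) := by
    refine (Finset.sum_congr rfl fun mi _ => ?_).trans Finset.sum_comm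
    refine (Finset.sum_congr rfl fun f _ => ?_).trans Finset.sum_comm
    rw [← Finset.sum_mul, Finset.sum_ite_eq', if_pos (Finset.mem_univ _), one_mul]
  rw [hsplit]
  refine Finset.sum_le_sum fun x _ => max_le ?_ ?_
  · rw [← sum_center_mul_pObs_Fmax g s]
    gcongr
    exact le_max_left _ _
  · rw [← sum_center_mul_pObs_Fmax g s]
    gcongr
    exact le_max_right _ _

lemma pObs_Fmin {N : ℕ} (g : Bits N → Bool) (s : Profile N) (i : Fin N) (bi mi : Bool)
    (f : Bits N) (v : Bool) :
    pObs g s (Fmin N) i bi mi f v =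
      (strandP (s i) bi mi * (PMF.uniformOfFintype (Bits N) f).toReal) * bitProb g i bi v := by
  unfold pObs bitProb
  rw [Finset.mul_sum]
  refine Finset.sum_congr rfl fun b _ => ?_
  by_cases h : b i.succ = bi ∧ g b = v
  · obtain ⟨rfl, rfl⟩ := h
    rw [← sum_msgP_own s b i mi, Finset.sum_mul, Finset.sum_mul]
    refine Finset.sum_congr rfl fun m _ => ?_
    by_cases hm : m i.succ = mi
    · simp [hm, jointP, Fmin]
      ring
    · simp [hm]
  · rw [if_neg h, mul_zero]
    exact Finset.sum_eq_zero fun m _ => if_neg fun hm => h ⟨hm.1, hm.2.2⟩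

/-- Random replies give exactly the profit of guessing from one's own bit alone. -/
lemma V_Fmin_eq_bitProb {N : ℕ} (g : Bits N → Bool) (c : Fin N → ℝ) (s : Profile N)
    (i : Fin N) :
    V g c s (Fmin N) i = c i * ∑ bi, max (bitProb g i bi true) (bitProb g i bi false) := by
  rw [V_eq_sum_max]
  congr 1
  refine Finset.sum_congr rfl fun bi _ => ?_
  have hmax (mi : Bool) (f : Bits N) :
      max (pObs g s (Fmin N) i bi mi f true) (pObs g s (Fmin N) i bi mi f false) =
        (strandP (s i) bi mi * (PMF.uniformOfFintype (Bits N) f).toReal) *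
          max (bitProb g i bi true) (bitProb g i bi false) := by
    rw [pObs_Fmin, pObs_Fmin, mul_max_of_nonneg]
    exact mul_nonneg (strandP_nonneg _ _ _) ENNReal.toReal_nonneg
  simp only [hmax, ← Finset.sum_mul, ← Finset.mul_sum]
  rw [sum_toReal_pmf, mul_one, sum_strandP, one_mul]

lemma pObs_of_zeroInfo {N : ℕ} (g : Bits N → Bool) {s : Profile N} (F : Protocol N) {i : Fin N}
    (hs : ∀ j, j ≠ i → ZeroInfo (s j)) (bi mi : Bool) (f : Bits N) (v : Bool) :
    pObs g s F i bi mi f v = ∑ m, (if m i.succ = mi then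
      (∏ j, strandP (s j) bi (m j.succ)) * (F s m f).toReal else 0) *
        centerProb g i bi (m 0) v := by
  unfold pObs centerProb
  rw [Finset.sum_comm]
  refine Finset.sum_congr rfl fun m _ => ?_
  rw [Finset.mul_sum]
  refine Finset.sum_congr rfl fun b _ => ?_
  by_cases h : b i.succ = bi ∧ g b = v
  · obtain ⟨rfl, rfl⟩ := h
    by_cases hm : m i.succ = mi
    · have hprod : ∏ j, strandP (s j) (b j.succ) (m j.succ) =
          ∏ j, strandP (s j) (b i.succ) (m j.succ) := by
        refine Finset.prod_congr rfl fun j _ => ?_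
        rcases eq_or_ne j i with rfl | hj
        · rfl
        · exact strandP_eq_of_zeroInfo (hs j hj) _ _ _
      simp only [hm, jointP, msgP, hprod, and_self, if_true]
      ring
    · simp [hm]
  · rw [if_neg h, mul_zero]
    exact if_neg fun hm => h ⟨hm.1, hm.2.2⟩

/-- If all other agents reveal nothing, no protocol gives more than the profit of guessing from
one's own bit and the center's bit. -/
lemma V_le_centerProb {N : ℕ} (g : Bits N → Bool) {c : Fin N → ℝ} {s : Profile N}
    (F : Protocol N) {i : Fin N} (hc : 0 < c i) (hs : ∀ j, j ≠ i → ZeroInfo (s j)) :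
    V g c s F i ≤
      c i * ∑ bi, ∑ x, max (centerProb g i bi x true) (centerProb g i bi x false) := by
  rw [V_eq_sum_max]
  refine mul_le_mul_of_nonneg_left (Finset.sum_le_sum fun bi _ => ?_) hc.le
  set M : Bool → ℝ := fun x => max (centerProb g i bi x true) (centerProb g i bi x false)
  set K : Bool → Bits N → Bits N → ℝ := fun mi f m => if m i.succ = mi then
      (∏ j, strandP (s j) bi (m j.succ)) * (F s m f).toReal else 0
  have hK (mi f m) : 0 ≤ K mi f m := by
    simp only [K]
    split_ifs
    · exact mul_nonneg (Finset.prod_nonneg fun _ _ => strandP_nonneg _ _ _) ENNReal.toReal_nonneg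
    · exact le_rfl
  have hmax (mi : Bool) (f : Bits N) :
      max (pObs g s F i bi mi f true) (pObs g s F i bi mi f false) ≤ ∑ m, K mi f m * M (m 0) := by
    rw [pObs_of_zeroInfo g F hs, pObs_of_zeroInfo g F hs]
    exact max_le
      (Finset.sum_le_sum fun m _ => mul_le_mul_of_nonneg_left (le_max_left _ _) (hK mi f m))
      (Finset.sum_le_sum fun m _ => mul_le_mul_of_nonneg_left (le_max_right _ _) (hK mi f m))
  have hsum (m : Bits N) : ∑ mi, ∑ f, K mi f m = ∏ j, strandP (s j) bi (m j.succ) := by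
    rw [Finset.sum_comm]
    simp only [K, Finset.sum_ite_eq, Finset.mem_univ, if_true]
    rw [← Finset.mul_sum, sum_toReal_pmf, mul_one]
  calc _ ≤ ∑ mi, ∑ f, ∑ m, K mi f m * M (m 0) :=
        Finset.sum_le_sum fun mi _ => Finset.sum_le_sum fun f _ => hmax mi f
    _ = ∑ m, (∑ mi, ∑ f, K mi f m) * M (m 0) := by
        simp only [Finset.sum_mul]
        rw [Finset.sum_comm (s := (Finset.univ : Finset (Bits N)))]
        refine Finset.sum_congr rfl fun mi _ => ?_
        exact Finset.sum_comm
    _ = ∑ m : Bits N, M (m 0) * ∏ j, strandP (s j) bi (m j.succ) := by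
        simp only [hsum, mul_comm]
    _ = ∑ x, M x := sum_bits_mul_prod_strandP M s fun _ => bi

/-- A continuous price has arbitrarily small values at informative strategies. -/
lemma le_zero_of_forall_le_price {p : Strategy → ℝ} (hcont : Continuous p)
    (h0 : ∀ s, ZeroInfo s → p s = 0) {K : ℝ} (hK : ∀ s, ¬ ZeroInfo s → K ≤ p s) : K ≤ 0 := by
  let γ : ℝ → Strategy := fun t => (Set.projIcc 0 1 zero_le_one t, ⟨0, by norm_num⟩)
  have hγ : Continuous γ := by
    exact continuous_projIcc.prodMk continuous_const
  have hzero : p (γ 0) = 0 := h0 _ (by simp [γ, ZeroInfo])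
  have hlim : Filter.Tendsto (fun t => p (γ t)) (nhdsWithin 0 (Set.Ioi 0)) (nhds 0) := by
    have h := (hcont.comp hγ).tendsto 0
    rw [Function.comp_apply, hzero] at h
    exact h.mono_left nhdsWithin_le_nhds
  refine ge_of_tendsto hlim (eventually_nhdsWithin_of_forall fun t ht => hK _ ?_)
  have ht' : (0:ℝ) < t := ht
  simp [γ, ZeroInfo, Set.coe_projIcc, ht']

lemma Fc_of_zeroInfo {N : ℕ} (hN : 2 ≤ N) {price : Fin N → Strategy → ℝ}
    (hprice0 : ∀ i s, ZeroInfo s → price i s = 0) {s : Profile N} (hs : ∀ j, ZeroInfo (s j))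
    (i : Fin N) : Fc price i s = Fmin N s := by
  have : Nontrivial (Fin N) := Fin.nontrivial_iff_two_le.2 hN
  obtain ⟨j, hj⟩ := exists_ne i
  have h1 : ¬ ∀ j, s j = sT := fun h => not_zeroInfo_sT (h i ▸ hs i)
  have h2 : ¬ ∀ j, j ≠ i → priceR price j (s j) < priceR price i (s i) := fun h => by
    simpa [priceR, hprice0 _ _ (hs _)] using h j hj
  funext m
  simp only [Fc, Fmin, if_neg h1, if_neg h2]

lemma Fc_update_of_zeroInfo {N : ℕ} {price : Fin N → Strategy → ℝ}
    (hprice0 : ∀ i s, ZeroInfo s → price i s = 0)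
    (hpricePos : ∀ i s, ¬ ZeroInfo s → 0 < price i s) {s : Profile N} (hs : ∀ j, ZeroInfo (s j))
    (i : Fin N) {si : Strategy} (hsi : ¬ ZeroInfo si) :
    Fc price i (Function.update s i si) = Fmax N (Function.update s i si) := by
  have h : ∀ j, j ≠ i → priceR price j (Function.update s i si j) <
      priceR price i (Function.update s i si i) := fun j hj => by
    rw [Function.update_of_ne hj, Function.update_self, priceR, hprice0 j _ (hs j), zero_div]
    exact div_pos (hpricePos i si hsi) (hpricePos i sT not_zeroInfo_sT)
  funext m
  simp only [Fc, Fmax, if_pos h, ite_self]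

/-- zero-information profiles are equilibria of the competitive protocol
iff they are equilibria of every protocol. -/
theorem zeroinfo_equilibria_Fc_iff_all (N : ℕ) (hN : 2 ≤ N) (g : Bits N → Bool) (c : Fin N → ℝ)
    (hc : ∀ i, 0 < c i)
    (price : Fin N → Strategy → ℝ)
    (hpriceCont : ∀ i, Continuous (price i))
    (hprice0 : ∀ i s, ZeroInfo s → price i s = 0)
    (hpricePos : ∀ i s, ¬ ZeroInfo s → 0 < price i s)
    (hpriceMax : ∀ i s, price i s ≤ price i sT) :
    (∀ sr : Profile N, (∀ j, ZeroInfo (sr j)) →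
        Equilibrium g c price sr (Fc price)) ↔
      (∀ FF : Fin N → Protocol N, ∀ sr : Profile N, (∀ j, ZeroInfo (sr j)) →
        Equilibrium g c price sr FF) := by
  refine ⟨fun h FF sr hsr i s' => ?_, fun h => h _⟩
  have hgap : c i * ∑ bi, ∑ x, max (centerProb g i bi x true) (centerProb g i bi x false) -
      c i * ∑ bi, max (bitProb g i bi true) (bitProb g i bi false) ≤ 0 := by
    refine le_zero_of_forall_le_price (hpriceCont i) (hprice0 i) fun si hsi => ?_
    have heq := h sr hsr i si
    unfold U at heq
    rw [V_congr g c (Fc_of_zeroInfo hN hprice0 hsr i),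
      V_congr g c (Fc_update_of_zeroInfo hprice0 hpricePos hsr i hsi), V_Fmin_eq_bitProb,
      hprice0 i _ (hsr i), Function.update_self] at heq
    linarith [V_Fmax_ge_centerProb g (Function.update sr i si) (hc i)]
  have hprice : 0 ≤ price i s' := by
    by_cases hs : ZeroInfo s'
    · exact (hprice0 i s' hs).ge
    · exact (hpricePos i s' hs).le
  have hothers : ∀ j, j ≠ i → ZeroInfo (Function.update sr i s' j) := fun j hj => by
    rw [Function.update_of_ne hj]
    exact hsr j
  unfold U
  rw [hprice0 i _ (hsr i), Function.update_self]
  linarith [V_ge_bitProb g sr (FF i) (hc i), V_le_centerProb g (FF i) (hc i) hothers]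

end
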